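/- Let D be a discrete space of cardinality non(M). Then the closed interval [0,1] and the one-point compactification αD are both hereditarily supercompact, but their product [0,1] × αD is not hereditarily supercompact. In particular, hereditary supercompactness is not preserved by finite products. -/

import Mathlib

open Set Topology TopologicalSpace

universe u

/-- A topological space is *supercompact* if it has a subbase `S` for its topology such that
every cover of the space by members of `S` has a subcover with at most two members. -/
def IsSupercompact (X : Type*) [t : TopologicalSpace X] : Prop :=
  ∃ S : Set (Set X), TopologicalSpace.generateFrom S = t ∧
    ∀ C ⊆ S, ⋃₀ C = univ → ∃ T ⊆ C, T.Finite ∧ T.ncard ≤ 2 ∧ ⋃₀ T = univ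

/-- A topological space is *hereditarily supercompact* if each of its closed subspaces is
supercompact. -/
def IsHereditarilySupercompact (X : Type*) [TopologicalSpace X] : Prop :=
  ∀ Z : Set X, IsClosed Z → IsSupercompact Z

/-- `non(M)`: the smallest cardinality of a non-meager subset of the real line. -/
noncomputable def nonMeagerCard : Cardinal :=
  sInf {c : Cardinal | ∃ A : Set ℝ, ¬ IsMeagre A ∧ Cardinal.mk A = c}

/-- The union of a finite chain of sets is covered by at most one of its members. -/
lemma exists_subset_ncard_le_one_of_isChain {X : Type*} {C : Set (Set X)} (hfin : C.Finite)
    (hC : IsChain (· ⊆ ·) C) : ∃ T ⊆ C, T.Finite ∧ T.ncard ≤ 1 ∧ ⋃₀ C ⊆ ⋃₀ T := by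
  rcases C.eq_empty_or_nonempty with rfl | hne
  · exact ⟨∅, Subset.rfl, finite_empty, by simp, Subset.rfl⟩
  · obtain ⟨m, hm⟩ := hfin.exists_maximal hne
    refine ⟨{m}, by simpa using hm.prop, finite_singleton m, by simp, ?_⟩
    rintro x ⟨s, hs, hx⟩
    refine ⟨m, rfl, ?_⟩
    rcases hC.total hs hm.prop with h | h
    · exact h hx
    · exact hm.le_of_ge hs h hx

lemma isSupercompact_of_isChain_union {X : Type*} [t : TopologicalSpace X] [CompactSpace X]
    {S₁ S₂ : Set (Set X)} (hS : TopologicalSpace.generateFrom (S₁ ∪ S₂) = t)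
    (h₁ : IsChain (· ⊆ ·) S₁) (h₂ : IsChain (· ⊆ ·) S₂) : IsSupercompact X := by
  refine ⟨S₁ ∪ S₂, hS, fun C hC hcov ↦ ?_⟩
  obtain ⟨F, hFC, hF, hFcov⟩ := isCompact_univ.elim_finite_subcover_image (b := C)
    (c := id) (fun s hs ↦ by rw [← hS]; exact isOpen_generateFrom_of_mem (hC hs))
    (by rw [← hcov, sUnion_eq_biUnion]; rfl)
  obtain ⟨T₁, hT₁, hf₁, hc₁, hu₁⟩ := exists_subset_ncard_le_one_of_isChain
    (hF.subset inter_subset_left) (h₁.mono (s := F ∩ S₁) inter_subset_right)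
  obtain ⟨T₂, hT₂, hf₂, hc₂, hu₂⟩ := exists_subset_ncard_le_one_of_isChain
    (hF.subset inter_subset_left) (h₂.mono (s := F ∩ S₂) inter_subset_right)
  refine ⟨T₁ ∪ T₂, union_subset (fun s hs ↦ hFC (hT₁ hs).1) (fun s hs ↦ hFC (hT₂ hs).1),
    hf₁.union hf₂, (ncard_union_le _ _).trans (by omega), eq_univ_of_univ_subset ?_⟩
  intro x hx
  obtain ⟨s, hs, hxs⟩ := mem_iUnion₂.1 (hFcov hx)
  rw [sUnion_union]
  rcases hC (hFC hs) with h | h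
  · exact Or.inl (hu₁ ⟨s, ⟨hs, h⟩, hxs⟩)
  · exact Or.inr (hu₂ ⟨s, ⟨hs, h⟩, hxs⟩)

lemma isHereditarilySupercompact_of_linearOrder {X : Type*} [LinearOrder X] [TopologicalSpace X]
    [OrderTopology X] [CompactSpace X] : IsHereditarilySupercompact X := by
  intro Z hZ
  have : CompactSpace Z := isCompact_iff_compactSpace.1 hZ.isCompact
  refine isSupercompact_of_isChain_union (S₁ := range fun a : X ↦ ((↑) : Z → X) ⁻¹' Ioi a)
    (S₂ := range fun a : X ↦ ((↑) : Z → X) ⁻¹' Iio a) ?_ ?_ ?_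
  · have htop : _ = generateFrom {s : Set X | ∃ a, s = Ioi a ∨ s = Iio a} :=
      ‹OrderTopology X›.topology_eq_generate_intervals
    rw [instTopologicalSpaceSubtype, htop, induced_generateFrom_eq]
    congr 1
    ext s
    constructor
    · rintro (⟨a, rfl⟩ | ⟨a, rfl⟩)
      exacts [⟨_, ⟨a, Or.inl rfl⟩, rfl⟩, ⟨_, ⟨a, Or.inr rfl⟩, rfl⟩]
    · rintro ⟨_, ⟨a, rfl | rfl⟩, rfl⟩
      exacts [Or.inl ⟨a, rfl⟩, Or.inr ⟨a, rfl⟩]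
  · rintro _ ⟨a, rfl⟩ _ ⟨b, rfl⟩ -
    rcases le_total a b with h | h
    exacts [Or.inr (preimage_mono (Ioi_subset_Ioi h)), Or.inl (preimage_mono (Ioi_subset_Ioi h))]
  · rintro _ ⟨a, rfl⟩ _ ⟨b, rfl⟩ -
    rcases le_total a b with h | h
    exacts [Or.inl (preimage_mono (Iio_subset_Iio h)), Or.inr (preimage_mono (Iio_subset_Iio h))]

lemma isSupercompact_of_isOpen_singleton {X : Type*} [t : TopologicalSpace X] [CompactSpace X]
    [T1Space X] (p : X) (hp : ∀ x ≠ p, IsOpen {x}) : IsSupercompact X := by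
  refine ⟨{s | ∃ x ≠ p, s = {x} ∨ s = {x}ᶜ}, le_antisymm ?_ ?_, fun C hC hcov ↦ ?_⟩
  · intro U hU
    by_cases hpU : p ∈ U
    · have hfin : Uᶜ.Finite := by
        refine hU.isClosed_compl.isCompact.finite (isDiscrete_iff_forall_mem_exists_isOpen.2 ?_)
        exact fun x hx ↦ ⟨{x}, hp x (fun h ↦ hx (h ▸ hpU)), by simpa using hx⟩
      have : U = ⋂ x ∈ Uᶜ, {x}ᶜ := by
        ext y
        simp only [mem_iInter, mem_compl_iff, mem_singleton_iff]
        exact ⟨fun hy x hx h ↦ hx (h ▸ hy), fun h ↦ by_contra fun hy ↦ h y hy rfl⟩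
      rw [this]
      refine @Set.Finite.isOpen_biInter _ _ (generateFrom _) _ _ hfin fun x hx ↦ ?_
      exact isOpen_generateFrom_of_mem ⟨x, fun h ↦ hx (h ▸ hpU), Or.inr rfl⟩
    · rw [← biUnion_of_singleton U]
      refine @isOpen_biUnion _ _ (generateFrom _) _ _ fun x hx ↦ ?_
      exact isOpen_generateFrom_of_mem ⟨x, fun h ↦ hpU (h ▸ hx), Or.inl rfl⟩
  · refine le_generateFrom ?_
    rintro _ ⟨x, hx, rfl | rfl⟩
    exacts [hp x hx, isOpen_compl_singleton]
  · obtain ⟨s, hs, hps⟩ := (hcov.ge : univ ⊆ _) (mem_univ p)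
    obtain ⟨x, hx, rfl | rfl⟩ := hC hs
    · exact absurd hps.symm hx
    obtain ⟨u, hu, hxu⟩ := (hcov.ge : univ ⊆ _) (mem_univ x)
    refine ⟨{{x}ᶜ, u}, by simp [insert_subset_iff, hs, hu], by simp,
      (ncard_insert_le _ _).trans (by simp), ?_⟩
    refine eq_univ_of_forall fun y ↦ ?_
    by_cases hy : y = x
    · exact ⟨u, by simp, hy ▸ hxu⟩
    · exact ⟨{x}ᶜ, by simp, hy⟩

lemma isHereditarilySupercompact_onePoint {D : Type*} [TopologicalSpace D] [DiscreteTopology D] :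
    IsHereditarilySupercompact (OnePoint D) := by
  intro Z hZ
  have : CompactSpace Z := isCompact_iff_compactSpace.1 hZ.isCompact
  have hopen : ∀ x : Z, (x : OnePoint D) ≠ OnePoint.infty → IsOpen {x} := by
    rintro ⟨x, hx⟩ hne
    obtain ⟨d, rfl⟩ := OnePoint.ne_infty_iff_exists.1 hne
    have : IsOpen ({(d : OnePoint D)} : Set (OnePoint D)) := by
      simpa using OnePoint.isOpenEmbedding_coe.isOpenMap _ (isOpen_discrete {d})
    convert this.preimage continuous_subtype_val
    ext y
    simp [Subtype.ext_iff]
  by_cases hinf : OnePoint.infty ∈ Z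
  · exact isSupercompact_of_isOpen_singleton ⟨_, hinf⟩ fun x hx ↦
      hopen x fun h ↦ hx (Subtype.ext h)
  · rcases isEmpty_or_nonempty Z with he | ⟨⟨p⟩⟩
    · exact isSupercompact_of_isChain_union (S₁ := ∅) (S₂ := ∅) (Subsingleton.elim _ _)
        IsChain.empty IsChain.empty
    · exact isSupercompact_of_isOpen_singleton p fun x _ ↦ hopen x fun h ↦ hinf (h ▸ x.2)

/-- The intersections of complements of members of a family `S` of open sets. -/
def ClosedBase {X : Type*} (S : Set (Set X)) : Set (Set X) :=
  {A | ∃ t ⊆ S, A = ⋂ s ∈ t, sᶜ}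

lemma isClosed_of_mem_closedBase {X : Type*} [t : TopologicalSpace X] {S : Set (Set X)}
    (hS : generateFrom S = t) {A : Set X} (hA : A ∈ ClosedBase S) : IsClosed A := by
  obtain ⟨T, hT, rfl⟩ := hA
  refine isClosed_biInter fun s hs ↦ IsOpen.isClosed_compl ?_
  rw [← hS]
  exact isOpen_generateFrom_of_mem (hT hs)

lemma inter_nonempty_of_mem_closedBase {X : Type*} {S : Set (Set X)}
    (hS : ∀ C ⊆ S, ⋃₀ C = univ → ∃ T ⊆ C, T.Finite ∧ T.ncard ≤ 2 ∧ ⋃₀ T = univ)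
    {A B C : Set X} (hA : A ∈ ClosedBase S) (hB : B ∈ ClosedBase S) (hC : C ∈ ClosedBase S)
    (hAB : (A ∩ B).Nonempty) (hAC : (A ∩ C).Nonempty) (hBC : (B ∩ C).Nonempty) :
    (A ∩ B ∩ C).Nonempty := by
  obtain ⟨a, ha, rfl⟩ := hA
  obtain ⟨b, hb, rfl⟩ := hB
  obtain ⟨c, hc, rfl⟩ := hC
  by_contra hne
  obtain ⟨T, hT, hfin, hcard, hcov⟩ := hS (a ∪ b ∪ c) (union_subset (union_subset ha hb) hc) (by
    refine eq_univ_of_forall fun x ↦ by_contra fun hx ↦ hne ⟨x, ?_⟩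
    simp only [mem_sUnion, mem_union, not_exists, not_and] at hx
    simp only [mem_inter_iff, mem_iInter, mem_compl_iff]
    exact ⟨⟨fun s hs ↦ hx s (.inl (.inl hs)), fun s hs ↦ hx s (.inl (.inr hs))⟩,
      fun s hs ↦ hx s (.inr hs)⟩)
  have key : ∀ {p q : Set (Set X)}, ((⋂ s ∈ p, sᶜ) ∩ ⋂ s ∈ q, sᶜ).Nonempty → ¬ T ⊆ p ∪ q := by
    rintro p q ⟨x, hxp, hxq⟩ hsub
    obtain ⟨s, hs, hxs⟩ := (hcov.ge : univ ⊆ _) (mem_univ x)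
    simp only [mem_iInter, mem_compl_iff] at hxp hxq
    rcases hsub hs with h | h
    exacts [hxp s h hxs, hxq s h hxs]
  obtain ⟨x, hx, hx'⟩ := not_subset.1 (key hAB)
  obtain ⟨y, hy, hy'⟩ := not_subset.1 (key hAC)
  obtain ⟨z, hz, hz'⟩ := not_subset.1 (key hBC)
  simp only [mem_union, not_or] at hx' hy' hz'
  have hxc := (hT hx).resolve_left (by simp [hx'])
  have hyb : y ∈ b := by have := hT hy; simp only [mem_union] at this; tauto
  have hza : z ∈ a := by have := hT hz; simp only [mem_union] at this; tauto
  have h3 : ({x, y, z} : Set (Set X)).ncard = 3 :=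
    ncard_eq_three.2 ⟨x, y, z, by grind, by grind, by grind, rfl⟩
  have := ncard_le_ncard (s := {x, y, z}) (by simp [insert_subset_iff, hx, hy, hz]) hfin
  omega

lemma exists_finset_closedBase {X : Type*} [t : TopologicalSpace X] [CompactSpace X]
    {S : Set (Set X)} (hS : generateFrom S = t) {A O : Set X} (hA : IsClosed A) (hO : IsOpen O)
    (hAO : A ⊆ O) : ∃ F : Finset (Set X), (∀ M ∈ F, M ∈ ClosedBase S ∧ M ⊆ O) ∧
      ∀ x ∈ A, ∃ M ∈ F, x ∈ M := by
  classical
  have hbasis := isTopologicalBasis_of_subbasis hS.symm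
  have hloc : ∀ y : X, y ∈ Oᶜ → ∃ f : Set (Set X), f.Finite ∧ f ⊆ S ∧ y ∈ ⋂₀ f ∧ ⋂₀ f ⊆ Aᶜ := by
    intro y hy
    obtain ⟨v, ⟨f, ⟨hf, hfS⟩, rfl⟩, hyv, hv⟩ :=
      hbasis.exists_subset_of_mem_open (show y ∈ Aᶜ from fun h ↦ hy (hAO h)) hA.isOpen_compl
    exact ⟨f, hf, hfS, hyv, hv⟩
  choose! f hf hfS hyf hfA using hloc
  obtain ⟨Y, hY, hcov⟩ := hO.isClosed_compl.isCompact.elim_nhds_subcover (fun y ↦ ⋂₀ f y)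
    (fun y hy ↦ (hbasis.isOpen ⟨f y, ⟨hf y hy, hfS y hy⟩, rfl⟩).mem_nhds (hyf y hy))
  have hfin : (⋃ y ∈ Y, f y).Finite := Y.finite_toSet.biUnion fun y hy ↦ hf y (hY y hy)
  have hfin' : {M : Set X | ∃ T ⊆ ⋃ y ∈ Y, f y, (∀ y ∈ Y, ∃ s ∈ T, s ∈ f y) ∧
      M = ⋂ s ∈ T, sᶜ}.Finite := by
    refine (hfin.finite_subsets.image fun T ↦ ⋂ s ∈ T, sᶜ).subset ?_
    rintro M ⟨T, hT, -, rfl⟩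
    exact ⟨T, hT, rfl⟩
  refine ⟨hfin'.toFinset, ?_, ?_⟩
  · intro M hM
    obtain ⟨T, hT, hTY, rfl⟩ := hfin'.mem_toFinset.1 hM
    refine ⟨⟨T, hT.trans (iUnion₂_subset fun y hy ↦ hfS y (hY y hy)), rfl⟩, fun x hx ↦ ?_⟩
    by_contra hxO
    obtain ⟨y, hy, hxy⟩ := mem_iUnion₂.1 (hcov hxO)
    obtain ⟨s, hs, hsy⟩ := hTY y hy
    exact mem_iInter₂.1 hx s hs (hxy s hsy)
  · intro x hx
    refine ⟨⋂ s ∈ {s ∈ ⋃ y ∈ Y, f y | x ∉ s}, sᶜ, hfin'.mem_toFinset.2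
      ⟨_, sep_subset _ _, fun y hy ↦ ?_, rfl⟩, mem_iInter₂.2 fun s hs ↦ hs.2⟩
    by_contra! h
    refine hfA y (hY y hy) (fun s hs ↦ by_contra fun hxs ↦ ?_) hx
    exact h s ⟨mem_iUnion₂.2 ⟨y, hy, hs⟩, hxs⟩ hs

/-- Part of a set covered by finitely many closed sets lies, locally somewhere, in one of them. -/
lemma exists_isOpen_inter_subset_of_finset_cover {X : Type*} [TopologicalSpace X] {K : Set X}
    (F : Finset (Set X)) (hF : ∀ N ∈ F, IsClosed N) {U : Set X} (hU : IsOpen U)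
    (hne : (K ∩ U).Nonempty) (hcov : ∀ x ∈ K ∩ U, ∃ N ∈ F, x ∈ N) :
    ∃ N ∈ F, ∃ V, IsOpen V ∧ (K ∩ V).Nonempty ∧ K ∩ V ⊆ N := by
  classical
  induction F using Finset.induction_on generalizing U with
  | empty => obtain ⟨x, hx⟩ := hne; simpa using hcov x hx
  | insert M F _ ih =>
    by_cases h : K ∩ U ⊆ M
    · exact ⟨M, by simp, U, hU, hne, h⟩
    · obtain ⟨x, hx, hxM⟩ := not_subset.1 h
      obtain ⟨N, hN, V, hV⟩ := ih (fun N hN ↦ hF N (by simp [hN])) (U := U ∩ Mᶜ)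
        (hU.inter (hF M (by simp)).isOpen_compl) ⟨x, hx.1, hx.2, hxM⟩ (by
          rintro y ⟨hyK, hyU, hyM⟩
          obtain ⟨N, hN, hyN⟩ := hcov y ⟨hyK, hyU⟩
          rcases Finset.mem_insert.1 hN with rfl | hN
          exacts [absurd hyN hyM, ⟨N, hN, hyN⟩])
      exact ⟨N, by simp [hN], V, hV⟩

/-- A nondegenerate interval has a nondegenerate subinterval on which the membership of a
continuous curve in each of finitely many closed sets is constant. -/
lemma exists_Ioo_forall_mem_or_forall_notMem {X : Type*} [TopologicalSpace X] {P : ℝ → X}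
    (hP : Continuous P) (F : Finset (Set X)) (hF : ∀ M ∈ F, IsClosed M) {x y : ℝ} (hxy : x < y) :
    ∃ x' y', x ≤ x' ∧ x' < y' ∧ y' ≤ y ∧
      ∀ M ∈ F, (∀ t ∈ Ioo x' y', P t ∈ M) ∨ ∀ t ∈ Ioo x' y', P t ∉ M := by
  classical
  induction F using Finset.induction_on generalizing x y with
  | empty => exact ⟨x, y, le_rfl, hxy, le_rfl, by simp⟩
  | insert M F _ ih =>
    have hF' : ∀ M ∈ F, IsClosed M := fun N hN ↦ hF N (by simp [hN])
    by_cases h : ∀ t ∈ Ioo x y, P t ∈ M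
    · obtain ⟨x', y', hx, hxy', hy, h'⟩ := ih hF' hxy
      refine ⟨x', y', hx, hxy', hy, fun N hN ↦ ?_⟩
      rcases Finset.mem_insert.1 hN with rfl | hN
      exacts [Or.inl fun t ht ↦ h t (Ioo_subset_Ioo hx hy ht), h' N hN]
    · push Not at h
      obtain ⟨t, ht, htM⟩ := h
      have hopen : IsOpen (Ioo x y ∩ P ⁻¹' Mᶜ) :=
        isOpen_Ioo.inter ((hF M (by simp)).isOpen_compl.preimage hP)
      obtain ⟨u, v, htuv, huv⟩ := mem_nhds_iff_exists_Ioo_subset.1 (hopen.mem_nhds ⟨ht, htM⟩)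
      obtain ⟨x', y', hx, hxy', hy, h'⟩ := ih hF' ((max_lt ht.1 htuv.1).trans
        (lt_min ht.2 htuv.2))
      refine ⟨x', y', (le_max_left _ _).trans hx, hxy', hy.trans (min_le_left _ _), fun N hN ↦ ?_⟩
      rcases Finset.mem_insert.1 hN with rfl | hN
      · exact Or.inr fun s hs ↦ (huv ⟨(le_max_right _ _).trans_lt (hx.trans_lt hs.1),
          (hs.2.trans_le hy).trans_le (min_le_right _ _)⟩).2
      · exact h' N hN

/-- If the type of small intervals to the right of `e` ranges over a finite set, then some type
occurs arbitrarily close to `e`. -/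
lemma exists_forall_pos_of_forall_pos_exists {α : Type*} (s : Finset α) (Q : α → ℝ → Prop)
    (hmono : ∀ T ε ε', ε ≤ ε' → Q T ε → Q T ε') (h : ∀ ε > 0, ∃ T ∈ s, Q T ε) :
    ∃ T ∈ s, ∀ ε > 0, Q T ε := by
  by_contra! hcon
  have : ∀ᶠ ε in 𝓝[>] (0 : ℝ), ∀ T ∈ s, ¬ Q T ε := by
    rw [Filter.eventually_all_finset]
    intro T hT
    obtain ⟨ε, hε, hQ⟩ := hcon T hT
    filter_upwards [Ioo_mem_nhdsGT hε] with δ hδ hQδ using hQ (hmono T _ _ hδ.2.le hQδ)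
  obtain ⟨ε, hε, hε0⟩ := (this.and self_mem_nhdsWithin).exists
  obtain ⟨T, hT, hQ⟩ := h ε hε0
  exact hε T hT hQ

lemma exists_intervals_forcing_notMem {X D : Type*} [t : TopologicalSpace X] [CompactSpace X]
    {S : Set (Set X)} (hS : generateFrom S = t)
    (hS₂ : ∀ C ⊆ S, ⋃₀ C = univ → ∃ T ⊆ C, T.Finite ∧ T.ncard ≤ 2 ∧ ⋃₀ T = univ)
    {π : X → ℝ} (hπ : Continuous π) {P : ℝ → X} (hP : Continuous P) {a b : ℝ}
    (hπP : ∀ x ∈ Icc a b, π (P x) = x) {L : D → Set X}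
    (hL : ∀ x ∈ Icc a b, ∀ O, IsOpen O → P x ∈ O →
      ∃ ε > 0, ∃ E : Finset D, ∀ d ∉ E, ∀ z ∈ L d, |π z - x| < ε → z ∈ O)
    (G : Finset (Set X)) (hG : ∀ M ∈ G, M ∈ ClosedBase S ∧ M ⊆ π ⁻¹' Ioo a b) {c : ℝ} (hac : a ≤ c)
    (hcb : c < b) (hc : ∃ x ∈ interior {x ∈ Icc a b | ∀ M ∈ G, P x ∈ M}, c < x) :
    ∃ l : Finset (ℝ × ℝ), ∃ E : Finset D, (∀ I ∈ l, c < I.1 ∧ I.1 < I.2 ∧ I.2 < b) ∧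
      (∀ I ∈ l, ∀ J ∈ l, I ≠ J → Disjoint (Ioo I.1 I.2) (Ioo J.1 J.2)) ∧
      ∀ d ∉ E, ∀ N ∈ ClosedBase S, N ⊆ L d → (∀ z ∈ L d, π z ∈ Ioo a b → z ∈ N) →
        (∀ z ∈ L d, π z ∈ Ioo c b → ∃ I ∈ l, π z ∈ Ioo I.1 I.2) →
        (∀ I ∈ l, ∃ z ∈ L d, π z ∈ Ioo I.1 I.2) → ∀ z ∈ N, π z ≤ c → ∀ M ∈ G, z ∉ M := by
  classical
  induction G using Finset.strongInduction generalizing c with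
  | H G ih =>
  rcases G.eq_empty_or_nonempty with rfl | ⟨M₀, hM₀⟩
  · exact ⟨∅, ∅, by simp⟩
  have hcl : ∀ M ∈ G, IsClosed M := fun M hM ↦ isClosed_of_mem_closedBase hS (hG M hM).1
  set C : Finset (Set X) → Set ℝ := fun G ↦ {x ∈ Icc a b | ∀ M ∈ G, P x ∈ M} with hC
  have hCclosed : IsClosed (C G) := by
    have : C G = Icc a b ∩ ⋂ M ∈ G, P ⁻¹' M := by ext x; simp [hC]
    rw [this]
    exact isClosed_Icc.inter (isClosed_biInter fun M hM ↦ (hcl M hM).preimage hP)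
  have hbdd : BddAbove (interior (C G)) := ⟨b, fun x hx ↦ (interior_subset hx).1.2⟩
  obtain ⟨x₀, hx₀, hcx₀⟩ := hc
  set e := sSup (interior (C G)) with he
  have hce : c < e := hcx₀.trans_le (le_csSup hbdd hx₀)
  have heC : e ∈ C G := hCclosed.closure_subset_iff.2 interior_subset
    (csSup_mem_closure ⟨x₀, hx₀⟩ hbdd)
  have heb : e < b := by
    have := (hG M₀ hM₀).2 (heC.2 M₀ hM₀)
    rw [mem_preimage, hπP e heC.1] at this
    exact this.2
  -- a proper subset of `G` describing the curve on intervals arbitrarily close to `e`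
  obtain ⟨T, hTG, hT⟩ := exists_forall_pos_of_forall_pos_exists G.powerset
    (fun T ε ↦ ∃ x y, e < x ∧ x < y ∧ y < e + ε ∧ y < b ∧
      ∀ M ∈ G, if M ∈ T then ∀ t ∈ Ioo x y, P t ∈ M else ∀ t ∈ Ioo x y, P t ∉ M)
    (fun T ε ε' hε ⟨x, y, h₁, h₂, h₃, h₄⟩ ↦ ⟨x, y, h₁, h₂, h₃.trans_le (by linarith), h₄⟩) (by
      intro ε hε
      obtain ⟨f, hf₁, hf₂⟩ := exists_between (lt_min (lt_add_of_pos_right e hε) heb)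
      obtain ⟨e', he'₁, he'₂⟩ := exists_between hf₁
      rw [lt_min_iff] at hf₂
      obtain ⟨x, y, hx, hxy, hy, hM⟩ := exists_Ioo_forall_mem_or_forall_notMem hP G hcl he'₂
      refine ⟨{M ∈ G | ∀ t ∈ Ioo x y, P t ∈ M}, by simp, x, y, by linarith, hxy, by linarith,
        by linarith, fun M hMG ↦ ?_⟩
      split_ifs with h
      · exact (Finset.mem_filter.1 h).2
      · exact (hM M hMG).resolve_left fun h' ↦ h (Finset.mem_filter.2 ⟨hMG, h'⟩))
  rw [Finset.mem_powerset] at hTG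
  have hTint : ∀ x y, e < x → y < b →
      (∀ M ∈ G, if M ∈ T then ∀ t ∈ Ioo x y, P t ∈ M else ∀ t ∈ Ioo x y, P t ∉ M) →
      Ioo x y ⊆ interior (C T) := by
    intro x y hx hy h
    refine interior_maximal (fun t ht ↦ ⟨⟨by linarith [ht.1, heC.1.1], by linarith [ht.2]⟩,
      fun M hM ↦ ?_⟩) isOpen_Ioo
    have := h M (hTG hM)
    rw [if_pos hM] at this
    exact this t ht
  have hTss : T ⊂ G := by
    refine hTG.ssubset_of_ne ?_
    rintro rfl
    obtain ⟨x, y, hx, hxy, -, hy, h⟩ := hT 1 one_pos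
    obtain ⟨t, ht⟩ := exists_between hxy
    exact (hx.trans ht.1).not_ge (le_csSup hbdd (hTint x y hx hy h ht))
  -- first fix what happens to the right of `e`
  obtain ⟨c', hec', hc'b, hc'⟩ : ∃ c', e < c' ∧ c' < b ∧ ∃ x ∈ interior (C T), c' < x := by
    obtain ⟨x, y, hx, hxy, -, hy, h⟩ := hT 1 one_pos
    obtain ⟨t, ht⟩ := exists_between hxy
    exact ⟨x, hx, hxy.trans hy, t, hTint x y hx hy h ht, ht.1⟩
  obtain ⟨l, E, hl, hdisj, hkill⟩ := ih T hTss (fun M hM ↦ hG M (hTG hM)) (by linarith) hc'b hc'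
  obtain ⟨δ, hδ, hδc, hδc'⟩ : ∃ δ > 0, c < e - δ ∧ e + δ < c' := by
    obtain ⟨δ, hδ, h⟩ := exists_between (lt_min (sub_pos.2 hce) (sub_pos.2 hec'))
    rw [lt_min_iff] at h
    exact ⟨δ, hδ, by linarith, by linarith⟩
  obtain ⟨F, hF, hFcov⟩ := exists_finset_closedBase hS (A := π ⁻¹' Icc (e - δ / 2) (e + δ / 2))
    (O := π ⁻¹' Ioo (e - δ) (e + δ)) (isClosed_Icc.preimage hπ) (isOpen_Ioo.preimage hπ)
    (preimage_mono (Icc_subset_Ioo (by linarith) (by linarith)))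
  obtain ⟨ε, hε, E₁, hE₁⟩ := hL e heC.1 (⋂ M ∈ {M ∈ F | P e ∉ M}, Mᶜ)
    (isOpen_biInter_finset fun M hM ↦ (isClosed_of_mem_closedBase hS
      (hF M (Finset.mem_filter.1 hM).1).1).isOpen_compl) (by simp)
  obtain ⟨x, y, hx, hxy, hy, hyb, hxyT⟩ := hT (min ε (δ / 2)) (lt_min hε (by linarith))
  obtain ⟨w, hw⟩ := exists_between hxy
  obtain ⟨ε', hε', E₂, hE₂⟩ := hL w ⟨by linarith [hw.1, heC.1.1], by linarith [hw.2]⟩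
    (⋂ M ∈ G \ T, Mᶜ) (isOpen_biInter_finset fun M hM ↦
      (hcl M (Finset.mem_sdiff.1 hM).1).isOpen_compl) (by
      simp only [mem_iInter, Finset.mem_sdiff, mem_compl_iff, and_imp]
      intro M hM hMT
      have := hxyT M hM
      rw [if_neg hMT] at this
      exact this w hw)
  have hyε : y < e + ε := hy.trans_le (by gcongr; exact min_le_left _ _)
  have hyδ : y < e + δ / 2 := hy.trans_le (by gcongr; exact min_le_right _ _)
  set x' := max x (w - ε') with hx'
  set y' := min y (w + ε') with hy'
  have hxx' : x ≤ x' := le_max_left _ _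
  have hyy' : y' ≤ y := min_le_left _ _
  have hx'w : x' < w := max_lt hw.1 (by linarith)
  have hwy' : w < y' := lt_min hw.2 (by linarith)
  have hx'ε : w - ε' ≤ x' := le_max_right _ _
  have hy'ε : y' ≤ w + ε' := min_le_right _ _
  refine ⟨insert (x', y') l, E ∪ E₁ ∪ E₂, ?_, ?_, ?_⟩
  · intro I hI
    rcases Finset.mem_insert.1 hI with rfl | hI
    · exact ⟨by dsimp only; linarith, by dsimp only; linarith, by dsimp only; linarith⟩
    · exact ⟨by linarith [(hl I hI).1], (hl I hI).2⟩
  · have haux : ∀ I ∈ l, Disjoint (Ioo x' y') (Ioo I.1 I.2) := fun I hI ↦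
      disjoint_left.2 fun s hs hs' ↦ by linarith [hs.2, hs'.1, (hl I hI).1]
    intro I hI J hJ hIJ
    rcases Finset.mem_insert.1 hI with rfl | hI <;> rcases Finset.mem_insert.1 hJ with rfl | hJ
    exacts [absurd rfl hIJ, haux J hJ, (haux I hI).symm, hdisj I hI J hJ hIJ]
  intro d hd N hN hNL hLN hcov hhit z hz hzc M hM hzM
  simp only [Finset.mem_union, not_or] at hd
  have hMT : M ∉ T := by
    refine fun hMT ↦ hkill d hd.1.1 N hN hNL hLN (fun s hs hsc ↦ ?_)
      (fun I hI ↦ hhit I (Finset.mem_insert_of_mem hI)) z hz (by linarith) M hMT hzM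
    obtain ⟨I, hI, hsI⟩ := hcov s hs ⟨by linarith [hsc.1], hsc.2⟩
    rcases Finset.mem_insert.1 hI with rfl | hI
    · linarith [hsI.2, hsc.1]
    · exact ⟨I, hI, hsI⟩
  obtain ⟨s, hs, hsI⟩ := hhit _ (Finset.mem_insert_self _ _)
  dsimp only at hsI
  have hsN : s ∈ N := hLN s hs ⟨by linarith [hsI.1], by linarith [hsI.2]⟩
  obtain ⟨M', hM', hsM'⟩ := hFcov s ⟨by linarith [hsI.1], by linarith [hsI.2]⟩
  have heM' : P e ∈ M' := by
    by_contra heM'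
    have := hE₁ d hd.1.2 s hs (by rw [abs_lt]; constructor <;> linarith [hsI.1, hsI.2])
    simp only [mem_iInter, Finset.mem_filter, mem_compl_iff, and_imp] at this
    exact this M' hM' heM' hsM'
  obtain ⟨r, ⟨hrM, hrM'⟩, hrN⟩ := inter_nonempty_of_mem_closedBase hS₂ (hG M hM).1 (hF M' hM').1 hN
    ⟨P e, heC.2 M hM, heM'⟩ ⟨z, hzM, hz⟩ ⟨s, hsM', hsN⟩
  have hrδ : π r ∈ Ioo (e - δ) (e + δ) := (hF M' hM').2 hrM'
  obtain ⟨I, hI, hrI⟩ := hcov r (hNL hrN) ⟨by linarith [hrδ.1], by linarith [hrδ.2]⟩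
  rcases Finset.mem_insert.1 hI with rfl | hI
  · have := hE₂ d hd.2 r (hNL hrN) (by
      dsimp only at hrI
      rw [abs_lt]; constructor <;> linarith [hrI.1, hrI.2])
    simp only [mem_iInter, Finset.mem_sdiff, mem_compl_iff, and_imp] at this
    exact this M hM hMT hrM
  · linarith [hrδ.2, hrI.1, (hl I hI).1]

/-- A family of sets of reals is generic if, whenever each of its members `K d` is assigned a
rational interval meeting it, there are one such interval and a subinterval `[a, b]` of it in which
members assigned that interval realize every prescribed finite pattern of open intervals. -/
def IsGenericFamily {D : Type*} (K : D → Set ℝ) : Prop :=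
  ∀ g : D → ℚ × ℚ, (∀ d, (K d ∩ Ioo ((g d).1 : ℝ) (g d).2).Nonempty) →
    ∃ (i : ℚ × ℚ) (a b : ℝ), a < b ∧ Icc a b ⊆ Ioo (i.1 : ℝ) i.2 ∧ Icc a b ⊆ Icc 0 1 ∧
      ∀ l : Finset (ℝ × ℝ), l.Nonempty → (∀ I ∈ l, a < I.1 ∧ I.1 < I.2 ∧ I.2 < b) →
        (∀ I ∈ l, ∀ J ∈ l, I ≠ J → Disjoint (Ioo I.1 I.2) (Ioo J.1 J.2)) →
        ∀ E : Finset D, ∃ d ∉ E, g d = i ∧ K d ∩ Icc a b ⊆ ⋃ I ∈ l, Ioo I.1 I.2 ∧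
          ∀ I ∈ l, (K d ∩ Ioo I.1 I.2).Nonempty

theorem not_isSupercompact_of_isGenericFamily {X D : Type*} [TopologicalSpace X] [CompactSpace X]
    {π : X → ℝ} (hπ : Continuous π) {P : ℝ → X} (hP : Continuous P)
    (hπP : ∀ x ∈ Icc (0 : ℝ) 1, π (P x) = x) {L : D → Set X} (hLclopen : ∀ d, IsClopen (L d))
    (hLne : ∀ d, (L d).Nonempty) (hinj : ∀ d, InjOn π (L d))
    (hL : ∀ x ∈ Icc (0 : ℝ) 1, ∀ O, IsOpen O → P x ∈ O →
      ∃ ε > 0, ∃ E : Finset D, ∀ d ∉ E, ∀ z ∈ L d, |π z - x| < ε → z ∈ O)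
    (hgen : IsGenericFamily fun d ↦ π '' L d) : ¬ IsSupercompact X := by
  classical
  rintro ⟨S, hS, hS₂⟩
  have hN : ∀ d, ∃ N ∈ ClosedBase S, N ⊆ L d ∧ ∃ i : ℚ × ℚ,
      (π '' L d ∩ Ioo (i.1 : ℝ) i.2).Nonempty ∧ ∀ z ∈ L d, π z ∈ Ioo (i.1 : ℝ) i.2 → z ∈ N := by
    intro d
    obtain ⟨F, hF, hFcov⟩ := exists_finset_closedBase hS (hLclopen d).1 (hLclopen d).2 Subset.rfl
    obtain ⟨_, hN, V, hV, ⟨v, hvL, hv⟩, hVN⟩ := exists_isOpen_inter_subset_of_finset_cover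
      (K := π '' L d) (F.image (π '' ·)) (by
        simp only [Finset.mem_image]
        rintro _ ⟨N, hN, rfl⟩
        exact ((isClosed_of_mem_closedBase hS (hF N hN).1).isCompact.image hπ).isClosed) isOpen_univ
      (by simpa using hLne d) (by
        rintro _ ⟨⟨z, hz, rfl⟩, -⟩
        obtain ⟨N, hN, hzN⟩ := hFcov z hz
        exact ⟨_, Finset.mem_image_of_mem _ hN, z, hzN, rfl⟩)
    obtain ⟨N, hNF, rfl⟩ := Finset.mem_image.1 hN
    obtain ⟨u, w, hvuw, huw⟩ := mem_nhds_iff_exists_Ioo_subset.1 (hV.mem_nhds hv)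
    obtain ⟨p, hp⟩ := exists_rat_btwn hvuw.1
    obtain ⟨q, hq⟩ := exists_rat_btwn hvuw.2
    refine ⟨N, (hF N hNF).1, (hF N hNF).2, (p, q), ⟨v, hvL, hp.2, hq.1⟩, fun z hz hzpq ↦ ?_⟩
    obtain ⟨z', hz', hzz'⟩ := hVN ⟨⟨z, hz, rfl⟩, huw ⟨hp.1.trans hzpq.1, hzpq.2.trans hq.2⟩⟩
    rwa [← hinj d ((hF N hNF).2 hz') hz hzz']
  choose N hNS hNL g hg hgN using hN
  obtain ⟨i, a, b, hab, habi, hab01, hpat⟩ := hgen g hg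
  obtain ⟨a', haa', ha'b⟩ := exists_between hab
  obtain ⟨b', ha'b', hb'b⟩ := exists_between ha'b
  obtain ⟨F, hF, hFcov⟩ := exists_finset_closedBase hS (A := π ⁻¹' Icc a' b')
    (O := π ⁻¹' Ioo a b) (isClosed_Icc.preimage hπ) (isOpen_Ioo.preimage hπ)
    (preimage_mono (Icc_subset_Ioo haa' hb'b))
  have hFcl : ∀ M ∈ F, IsClosed M := fun M hM ↦ isClosed_of_mem_closedBase hS (hF M hM).1
  obtain ⟨x, y, hx, hxy, hy, hM⟩ := exists_Ioo_forall_mem_or_forall_notMem hP F hFcl ha'b'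
  obtain ⟨v, hxv, hvy⟩ := exists_between hxy
  set G := {M ∈ F | P v ∈ M} with hGdef
  obtain ⟨ε, hε, E₁, hE₁⟩ := hL v (hab01 ⟨by linarith, by linarith⟩) (⋂ M ∈ {M ∈ F | P v ∉ M}, Mᶜ)
    (isOpen_biInter_finset fun M hM ↦ (hFcl M (Finset.mem_filter.1 hM).1).isOpen_compl) (by simp)
  obtain ⟨c, hvc, hc⟩ := exists_between (lt_min hvy (lt_add_of_pos_right v hε))
  obtain ⟨x', hx', hx'v⟩ := exists_between (max_lt hxv (sub_lt_self v hε))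
  rw [lt_min_iff] at hc
  rw [max_lt_iff] at hx'
  obtain ⟨l, E, hl, hdisj, hkill⟩ := exists_intervals_forcing_notMem hS hS₂ hπ hP
    (fun x hx ↦ hπP x (hab01 hx)) (fun x hx ↦ hL x (hab01 hx)) G
    (fun M hM ↦ hF M (Finset.mem_filter.1 hM).1) (c := c) (by linarith) (by linarith) (by
      obtain ⟨t, hct, hty⟩ := exists_between hc.1
      refine ⟨t, mem_interior.2 ⟨Ioo x y, fun s hs ↦ ⟨⟨by linarith [hs.1],
        by linarith [hs.2]⟩, fun M hMG ↦ ?_⟩, isOpen_Ioo, by linarith, hty⟩, hct⟩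
      obtain ⟨hMF, hvM⟩ := Finset.mem_filter.1 hMG
      exact (hM M hMF).resolve_right (fun h ↦ h v ⟨hxv, hvy⟩ hvM) s hs)
  obtain ⟨d, hd, rfl, hcov, hhit⟩ := hpat (insert (x', c) l) (Finset.insert_nonempty _ _) (by
      intro I hI
      rcases Finset.mem_insert.1 hI with rfl | hI
      · exact ⟨by dsimp only; linarith, by dsimp only; linarith, by dsimp only; linarith⟩
      · exact ⟨by linarith [(hl I hI).1], (hl I hI).2⟩) (by
      have haux : ∀ I ∈ l, Disjoint (Ioo x' c) (Ioo I.1 I.2) := fun I hI ↦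
        disjoint_left.2 fun s hs hs' ↦ by linarith [hs.2, hs'.1, (hl I hI).1]
      intro I hI J hJ hIJ
      rcases Finset.mem_insert.1 hI with rfl | hI <;> rcases Finset.mem_insert.1 hJ with rfl | hJ
      exacts [absurd rfl hIJ, haux J hJ, (haux I hI).symm, hdisj I hI J hJ hIJ]) (E ∪ E₁)
  simp only [Finset.mem_union, not_or] at hd
  obtain ⟨_, ⟨z, hz, rfl⟩, hzI⟩ := hhit _ (Finset.mem_insert_self _ _)
  dsimp only at hzI
  obtain ⟨M, hMF, hzM⟩ := hFcov z ⟨by linarith [hzI.1], by linarith [hzI.2]⟩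
  have hMG : M ∈ G := by
    refine Finset.mem_filter.2 ⟨hMF, by_contra fun hvM ↦ ?_⟩
    have := hE₁ d hd.2 z hz (by rw [abs_lt]; constructor <;> linarith [hzI.1, hzI.2])
    simp only [mem_iInter, Finset.mem_filter, mem_compl_iff, and_imp] at this
    exact this M hMF hvM hzM
  have hLN : ∀ z ∈ L d, π z ∈ Ioo a b → z ∈ N d := fun z hz hzab ↦
    hgN d z hz (habi (Ioo_subset_Icc_self hzab))
  refine hkill d hd.1 (N d) (hNS d) (hNL d) hLN (fun s hs hscb ↦ ?_) (fun I hI ↦ ?_) z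
    (hLN z hz ⟨by linarith [hzI.1], by linarith [hzI.2]⟩) hzI.2.le M hMG hzM
  · obtain ⟨I, hI, hsI⟩ := mem_iUnion₂.1 (hcov ⟨⟨s, hs, rfl⟩, by linarith [hscb.1], hscb.2.le⟩)
    rcases Finset.mem_insert.1 hI with rfl | hI
    · exact absurd hsI.2 (by dsimp only; linarith [hscb.1])
    · exact ⟨I, hI, hsI⟩
  · obtain ⟨_, ⟨s, hs, rfl⟩, hsI⟩ := hhit I (Finset.mem_insert_of_mem hI)
    exact ⟨s, hs, hsI⟩


/-- The parity of `⌊2 ^ n * r⌋`, that is, the `n`-th binary digit of `r`. -/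
noncomputable def binaryDigit (r : ℝ) (n : ℕ) : Bool := decide (Odd ⌊(2 : ℝ) ^ n * r⌋)

lemma floor_two_pow_mul_eq_of_floor_succ {r : ℝ} {n : ℕ} {j : ℤ} (c : Bool)
    (h : ⌊(2 : ℝ) ^ (n + 1) * r⌋ = 2 * j + c.toNat) : ⌊(2 : ℝ) ^ n * r⌋ = j := by
  rw [Int.floor_eq_iff, pow_succ] at h
  rw [Int.floor_eq_iff]
  cases c <;> norm_num at h <;> constructor <;> linarith [h.1, h.2]

lemma floor_two_pow_mul_congr {r r' : ℝ} {n m : ℕ} (hnm : n ≤ m)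
    (h : ⌊(2 : ℝ) ^ m * r⌋ = ⌊(2 : ℝ) ^ m * r'⌋) : ⌊(2 : ℝ) ^ n * r⌋ = ⌊(2 : ℝ) ^ n * r'⌋ := by
  induction m, hnm using Nat.le_induction with
  | base => exact h
  | succ m _ ih =>
    apply ih
    obtain ⟨j, c, hj⟩ : ∃ (j : ℤ) (c : Bool), ⌊(2 : ℝ) ^ (m + 1) * r⌋ = 2 * j + c.toNat := by
      rcases Int.even_or_odd' ⌊(2 : ℝ) ^ (m + 1) * r⌋ with ⟨j, hj | hj⟩
      exacts [⟨j, false, by simpa using hj⟩, ⟨j, true, by simpa using hj⟩]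
    rw [floor_two_pow_mul_eq_of_floor_succ c hj, floor_two_pow_mul_eq_of_floor_succ c (h ▸ hj)]

lemma exists_prefix_forall_exists_isOpen_binaryDigit {x y : ℝ} (hxy : x < y) :
    ∃ (N : ℕ) (s : ℕ → Bool), ∀ t : ℕ → Bool, (∀ n < N, t n = s n) → ∀ M : ℕ,
      ∃ O : Set ℝ, IsOpen O ∧ O.Nonempty ∧ O ⊆ Ioo x y ∧
        ∀ r ∈ O, ∀ n < M, binaryDigit r n = t n := by
  obtain ⟨N, hN⟩ : ∃ N : ℕ, 2 < (2 : ℝ) ^ N * (y - x) := by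
    obtain ⟨N, hN⟩ := pow_unbounded_of_one_lt (2 / (y - x)) (one_lt_two (α := ℝ))
    exact ⟨N, (div_lt_iff₀ (sub_pos.2 hxy)).1 hN⟩
  have h2 : ∀ n : ℕ, (0 : ℝ) < 2 ^ n := fun n ↦ by positivity
  set k : ℤ := ⌊(2 : ℝ) ^ N * x⌋ + 1 with hk
  have hk₁ : (2 : ℝ) ^ N * x < k := by push_cast [hk]; exact Int.lt_floor_add_one _
  have hk₂ : (k : ℝ) + 1 < 2 ^ N * y := by
    have := Int.floor_le ((2 : ℝ) ^ N * x)
    push_cast [hk]; nlinarith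
  have hkN : ⌊(2 : ℝ) ^ N * (k / 2 ^ N)⌋ = k := by
    rw [mul_div_cancel₀ _ (h2 N).ne', Int.floor_intCast]
  refine ⟨N + 1, binaryDigit (k / 2 ^ N), fun t ht M ↦ ?_⟩
  have key : ∀ m : ℕ, ∃ j : ℤ, ∀ r : ℝ, ⌊(2 : ℝ) ^ (N + m) * r⌋ = j →
      ⌊(2 : ℝ) ^ N * r⌋ = k ∧ ∀ n ≤ N + m, binaryDigit r n = t n := by
    intro m
    induction m with
    | zero =>
      refine ⟨k, fun r hr ↦ ⟨hr, fun n hn ↦ ?_⟩⟩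
      rw [ht n (by omega), binaryDigit, binaryDigit,
        floor_two_pow_mul_congr (r' := k / 2 ^ N) hn (by rw [hr, add_zero, hkN])]
    | succ m ih =>
      obtain ⟨j, hj⟩ := ih
      refine ⟨2 * j + (t (N + m + 1)).toNat, fun r hr ↦ ?_⟩
      obtain ⟨hr₁, hr₂⟩ := hj r (floor_two_pow_mul_eq_of_floor_succ _ hr)
      refine ⟨hr₁, fun n hn ↦ ?_⟩
      rcases hn.lt_or_eq with hn | rfl
      · exact hr₂ n (by omega)
      · rw [binaryDigit, hr, ← add_assoc]
        cases t (N + m + 1) <;> simp [parity_simps]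
  obtain ⟨j, hj⟩ := key M
  have hj' : ∀ r ∈ Ioo ((j : ℝ) / 2 ^ (N + M)) ((j + 1) / 2 ^ (N + M)),
      ⌊(2 : ℝ) ^ (N + M) * r⌋ = j := by
    intro r hr
    rw [Int.floor_eq_iff]
    have h₁ := (div_lt_iff₀ (h2 _)).1 hr.1
    have h₂ := (lt_div_iff₀ (h2 _)).1 hr.2
    constructor <;> linarith
  refine ⟨_, isOpen_Ioo, nonempty_Ioo.2 (div_lt_div_of_pos_right (lt_add_one _) (h2 _)),
    fun r hr ↦ ?_, fun r hr n hn ↦ (hj r (hj' r hr)).2 n (by omega)⟩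
  obtain ⟨h₁, h₂⟩ := Int.floor_eq_iff.1 (hj r (hj' r hr)).1
  exact ⟨lt_of_mul_lt_mul_left (hk₁.trans_le h₁) (h2 N).le,
    lt_of_mul_lt_mul_left (h₂.trans hk₂) (h2 N).le⟩

/-- The closed real interval with the given rational endpoints. -/
def ratIcc (q : ℚ × ℚ) : Set ℝ := Icc (q.1 : ℝ) q.2

/-- `τ` is a finite disjoint family of nondegenerate closed rational intervals, each of which is
contained in a member of `σ`, and each member of `σ` contains a member of `τ`. -/
structure IsIntervalRefinement (σ τ : Finset (ℚ × ℚ)) : Prop where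
  lt : ∀ q ∈ τ, q.1 < q.2
  disjoint : ∀ q ∈ τ, ∀ q' ∈ τ, q ≠ q' → Disjoint (ratIcc q) (ratIcc q')
  exists_superset : ∀ q ∈ τ, ∃ p ∈ σ, ratIcc q ⊆ ratIcc p
  exists_subset : ∀ p ∈ σ, ∃ q ∈ τ, ratIcc q ⊆ ratIcc p

lemma IsIntervalRefinement.refl_right {σ τ : Finset (ℚ × ℚ)} (h : IsIntervalRefinement σ τ) :
    IsIntervalRefinement τ τ :=
  ⟨h.lt, h.disjoint, fun q hq ↦ ⟨q, hq, Subset.rfl⟩, fun q hq ↦ ⟨q, hq, Subset.rfl⟩⟩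

lemma IsIntervalRefinement.trans {ρ σ τ : Finset (ℚ × ℚ)} (h : IsIntervalRefinement ρ σ)
    (h' : IsIntervalRefinement σ τ) : IsIntervalRefinement ρ τ := by
  refine ⟨h'.lt, h'.disjoint, fun q hq ↦ ?_, fun p hp ↦ ?_⟩
  · obtain ⟨p, hp, hqp⟩ := h'.exists_superset q hq
    obtain ⟨o, ho, hpo⟩ := h.exists_superset p hp
    exact ⟨o, ho, hqp.trans hpo⟩
  · obtain ⟨q, hq, hqp⟩ := h.exists_subset p hp
    obtain ⟨o, ho, hoq⟩ := h'.exists_subset q hq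
    exact ⟨o, ho, hoq.trans hqp⟩

lemma IsIntervalRefinement.erase_union {σ T : Finset (ℚ × ℚ)} (h : IsIntervalRefinement σ σ)
    {p : ℚ × ℚ} (hp : p ∈ σ) (hT : T.Nonempty) (hlt : ∀ q ∈ T, q.1 < q.2)
    (hdisj : ∀ q ∈ T, ∀ q' ∈ T, q ≠ q' → Disjoint (ratIcc q) (ratIcc q'))
    (hTp : ∀ q ∈ T, ratIcc q ⊆ ratIcc p) : IsIntervalRefinement σ (σ.erase p ∪ T) := by
  have hmix : ∀ q ∈ σ.erase p, ∀ q' ∈ T, Disjoint (ratIcc q) (ratIcc q') := fun q hq q' hq' ↦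
    (h.disjoint q (Finset.mem_of_mem_erase hq) p hp (Finset.ne_of_mem_erase hq)).mono_right
      (hTp q' hq')
  refine ⟨fun q hq ↦ ?_, fun q hq q' hq' hne ↦ ?_, fun q hq ↦ ?_, fun o ho ↦ ?_⟩
  · rcases Finset.mem_union.1 hq with hq | hq
    exacts [h.lt q (Finset.mem_of_mem_erase hq), hlt q hq]
  · rcases Finset.mem_union.1 hq with hq | hq <;> rcases Finset.mem_union.1 hq' with hq' | hq'
    exacts [h.disjoint q (Finset.mem_of_mem_erase hq) q' (Finset.mem_of_mem_erase hq') hne,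
      hmix q hq q' hq', (hmix q' hq' q hq).symm, hdisj q hq q' hq' hne]
  · rcases Finset.mem_union.1 hq with hq | hq
    exacts [⟨q, Finset.mem_of_mem_erase hq, Subset.rfl⟩, ⟨p, hp, hTp q hq⟩]
  · by_cases hop : o = p
    · obtain ⟨q, hq⟩ := hT
      exact ⟨q, Finset.mem_union_right _ hq, hop ▸ hTp q hq⟩
    · exact ⟨o, Finset.mem_union_left _ (Finset.mem_erase.2 ⟨hop, ho⟩), Subset.rfl⟩

/-- An enumeration of the finite sets of pairs of rationals that takes each value infinitely
often. -/
def candidateIntervals (n : ℕ) : Finset (ℚ × ℚ) :=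
  (Encodable.decode (Nat.unpair n).1).getD {(0, 1)}

lemma exists_le_candidateIntervals_eq (N : ℕ) (τ : Finset (ℚ × ℚ)) :
    ∃ n, N ≤ n ∧ candidateIntervals n = τ :=
  ⟨Nat.pair (Encodable.encode τ) N, Nat.right_le_pair _ _, by simp [candidateIntervals]⟩

open Classical in
/-- The finite family of intervals built from the first `n` bits of `t`: a bit equal to `true`
means that the family is replaced by the current candidate whenever that candidate refines it. -/
noncomputable def intervalStage (t : ℕ → Bool) : ℕ → Finset (ℚ × ℚ)
  | 0 => {(0, 1)}
  | n + 1 =>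
    if t n = true ∧ IsIntervalRefinement (intervalStage t n) (candidateIntervals n) then
      candidateIntervals n
    else intervalStage t n

lemma isIntervalRefinement_intervalStage_self (t : ℕ → Bool) (n : ℕ) :
    IsIntervalRefinement (intervalStage t n) (intervalStage t n) := by
  induction n with
  | zero =>
    refine ⟨?_, ?_, fun q hq ↦ ⟨q, hq, Subset.rfl⟩, fun q hq ↦ ⟨q, hq, Subset.rfl⟩⟩
    · simp [intervalStage]
    · simp only [intervalStage, Finset.mem_singleton]
      rintro q rfl q' rfl h
      exact absurd rfl h
  | succ n ih =>
    rw [intervalStage]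
    split_ifs with h
    exacts [h.2.refl_right, ih]

lemma isIntervalRefinement_intervalStage (t : ℕ → Bool) {n m : ℕ} (hnm : n ≤ m) :
    IsIntervalRefinement (intervalStage t n) (intervalStage t m) := by
  induction m, hnm using Nat.le_induction with
  | base => exact isIntervalRefinement_intervalStage_self t n
  | succ m _ ih =>
    rw [intervalStage]
    split_ifs with h
    exacts [ih.trans h.2, ih]

lemma intervalStage_congr {t t' : ℕ → Bool} {n : ℕ} (h : ∀ k < n, t k = t' k) :
    intervalStage t n = intervalStage t' n := by
  induction n with
  | zero => rfl
  | succ n ih =>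
    rw [intervalStage, intervalStage, ih fun k hk ↦ h k (by omega), h n (by omega)]

lemma exists_intervalStage_eq (t : ℕ → Bool) (n : ℕ) {τ : Finset (ℚ × ℚ)}
    (h : IsIntervalRefinement (intervalStage t n) τ) :
    ∃ (t' : ℕ → Bool) (m : ℕ), n ≤ m ∧ (∀ k < n, t' k = t k) ∧ intervalStage t' m = τ := by
  obtain ⟨m, hnm, hm⟩ := exists_le_candidateIntervals_eq n τ
  let t' : ℕ → Bool := fun k ↦ if k < n then t k else decide (k = m)
  have ht' : ∀ k < n, t' k = t k := fun k hk ↦ if_pos hk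
  have hstage : ∀ k, n ≤ k → k ≤ m → intervalStage t' k = intervalStage t n := by
    intro k hk
    induction k, hk using Nat.le_induction with
    | base => exact fun _ ↦ intervalStage_congr ht'
    | succ k hk ih =>
      intro hkm
      have : t' k = false := by simp [t', not_lt.2 hk, (show k ≠ m by omega)]
      rw [intervalStage, if_neg (by simp [this]), ih (by omega)]
  refine ⟨t', m + 1, by omega, ht', ?_⟩
  have : t' m = true := by simp [t', not_lt.2 hnm]
  rw [intervalStage, hm, if_pos ⟨this, by rwa [hstage m hnm le_rfl]⟩]

/-- The closed subset of `[0, 1]` that is the limit of the families `intervalStage t n`. -/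
def intervalLimit (t : ℕ → Bool) : Set ℝ := ⋂ n, ⋃ p ∈ intervalStage t n, ratIcc p

lemma isClosed_intervalLimit (t : ℕ → Bool) : IsClosed (intervalLimit t) :=
  isClosed_iInter fun _ ↦ Set.Finite.isClosed_biUnion (Finset.finite_toSet _) fun _ _ ↦ isClosed_Icc

lemma exists_ratIcc_of_mem_intervalLimit {t : ℕ → Bool} {x : ℝ} (hx : x ∈ intervalLimit t) (n : ℕ) :
    ∃ p ∈ intervalStage t n, x ∈ ratIcc p := by
  simpa using mem_iInter.1 hx n

lemma ratIcc_subset_of_mem_intervalStage {t : ℕ → Bool} {n : ℕ} {p : ℚ × ℚ}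
    (hp : p ∈ intervalStage t n) : ratIcc p ⊆ Icc 0 1 := by
  obtain ⟨q, hq, hpq⟩ :=
    (isIntervalRefinement_intervalStage t n.zero_le).exists_superset p hp
  rw [intervalStage, Finset.mem_singleton] at hq
  subst hq
  simpa [ratIcc] using hpq

lemma intervalLimit_subset (t : ℕ → Bool) : intervalLimit t ⊆ Icc 0 1 := fun _ hx ↦
  let ⟨_, hp, hxp⟩ := exists_ratIcc_of_mem_intervalLimit hx 0
  ratIcc_subset_of_mem_intervalStage hp hxp

lemma intervalLimit_inter_nonempty {t : ℕ → Bool} {n : ℕ} {p : ℚ × ℚ}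
    (hp : p ∈ intervalStage t n) : (intervalLimit t ∩ ratIcc p).Nonempty := by
  let U : ℕ → Set ℝ := fun m ↦ ⋃ q ∈ intervalStage t m, ratIcc q
  have hU : Antitone U := by
    intro m m' hm x hx
    obtain ⟨q, hq, hxq⟩ := mem_iUnion₂.1 hx
    obtain ⟨o, ho, hqo⟩ := (isIntervalRefinement_intervalStage t hm).exists_superset q hq
    exact mem_biUnion ho (hqo hxq)
  have hUc : ∀ m, IsClosed (U m) := fun m ↦
    Set.Finite.isClosed_biUnion (Finset.finite_toSet _) fun _ _ ↦ isClosed_Icc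
  obtain ⟨x, hx⟩ := IsCompact.nonempty_iInter_of_sequence_nonempty_isCompact_isClosed
    (fun m ↦ ratIcc p ∩ U (n + m))
    (fun m ↦ inter_subset_inter_right _ (hU (by omega)))
    (fun m ↦ by
      obtain ⟨q, hq, hqp⟩ :=
        (isIntervalRefinement_intervalStage t (Nat.le_add_right n m)).exists_subset p hp
      have hlt := (isIntervalRefinement_intervalStage_self t (n + m)).lt q hq
      have hmem : (q.1 : ℝ) ∈ ratIcc q := ⟨le_rfl, by exact_mod_cast hlt.le⟩
      exact ⟨q.1, hqp hmem, mem_biUnion hq hmem⟩)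
    (isCompact_Icc.inter_right (hUc _))
    (fun m ↦ isClosed_Icc.inter (hUc _))
  rw [mem_iInter] at hx
  exact ⟨x, mem_iInter.2 fun m ↦ hU (Nat.le_add_left m n) (hx m).2, (hx 0).1⟩

lemma intervalLimit_nonempty (t : ℕ → Bool) : (intervalLimit t).Nonempty :=
  (intervalLimit_inter_nonempty (t := t) (n := 0) (Finset.mem_singleton_self _)).left

lemma exists_rat_Icc_subset_Ioo {x y : ℝ} (hxy : x < y) :
    ∃ q : ℚ × ℚ, q.1 < q.2 ∧ ratIcc q ⊆ Ioo x y := by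
  obtain ⟨a, hxa, hay⟩ := exists_rat_btwn hxy
  obtain ⟨b, hab, hby⟩ := exists_rat_btwn hay
  exact ⟨(a, b), by exact_mod_cast hab, Icc_subset_Ioo hxa hby⟩

lemma exists_Ioo_subset_closure_image {D ι : Type*} [Countable ι] {r : D → ℝ}
    (hr : ¬ IsMeagre (range r)) (g : D → ι) :
    ∃ (i : ι) (x y : ℝ), x < y ∧ Ioo x y ⊆ closure (r '' {d | g d = i}) := by
  by_contra! hcon
  refine hr ((isMeagre_iUnion fun i ↦ IsNowhereDense.isMeagre (s := r '' {d | g d = i}) ?_).mono ?_)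
  · rw [IsNowhereDense, eq_empty_iff_forall_notMem]
    intro z hz
    obtain ⟨x, y, hzxy, hxy⟩ := mem_nhds_iff_exists_Ioo_subset.1 (mem_interior_iff_mem_nhds.1 hz)
    exact hcon i x y (hzxy.1.trans hzxy.2) hxy
  · rintro _ ⟨d, rfl⟩
    exact mem_iUnion.2 ⟨g d, d, rfl, rfl⟩

theorem isGenericFamily_intervalLimit {D : Type*} {r : D → ℝ} (hr : ¬ IsMeagre (range r)) :
    IsGenericFamily fun d ↦ intervalLimit (binaryDigit (r d)) := by
  classical
  intro g hg
  obtain ⟨i, α, β, hαβ, hcl⟩ := exists_Ioo_subset_closure_image hr g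
  obtain ⟨N, s, hs⟩ := exists_prefix_forall_exists_isOpen_binaryDigit hαβ
  -- the piece `{d | g d = i}` contains indices with any code extending `s`, outside any finite set
  have hpick : ∀ t : ℕ → Bool, (∀ n < N, t n = s n) → ∀ (M : ℕ) (E : Finset D),
      ∃ d ∉ E, g d = i ∧ ∀ n < M, binaryDigit (r d) n = t n := by
    intro t ht M E
    obtain ⟨O, hO, hOne, hOsub, hOt⟩ := hs t ht M
    have hfin : (r '' E).Finite := E.finite_toSet.image r
    obtain ⟨x, hxO, hxE⟩ := (hfin.countable.dense_compl ℝ).inter_open_nonempty O hO hOne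
    obtain ⟨_, ⟨hdO, hdE⟩, d, hd, rfl⟩ := mem_closure_iff.1 (hcl (hOsub hxO)) _
      (hO.inter hfin.isClosed.isOpen_compl) ⟨hxO, hxE⟩
    exact ⟨d, fun h ↦ hdE ⟨d, h, rfl⟩, hd, hOt _ hdO⟩
  obtain ⟨d, -, hdi, hd⟩ := hpick s (fun _ _ ↦ rfl) N ∅
  obtain ⟨x, hxK, hxi⟩ := hg d
  rw [hdi] at hxi
  obtain ⟨p, hp, hxp⟩ := exists_ratIcc_of_mem_intervalLimit hxK N
  have hplt := (isIntervalRefinement_intervalStage_self _ N).lt p hp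
  rw [intervalStage_congr hd] at hp
  have hlt : max (p.1 : ℝ) i.1 < min (p.2 : ℝ) i.2 := max_lt
    (lt_min (by exact_mod_cast hplt) (hxp.1.trans_lt hxi.2))
    (lt_min (hxi.1.trans_le hxp.2) (hxi.1.trans hxi.2))
  obtain ⟨q, hq, hqsub⟩ := exists_rat_Icc_subset_Ioo hlt
  have hqp : ratIcc q ⊆ ratIcc p := hqsub.trans fun z hz ↦
    ⟨(le_max_left _ _).trans hz.1.le, hz.2.le.trans (min_le_left _ _)⟩
  obtain ⟨t, n, hNn, hts, htn⟩ := exists_intervalStage_eq s N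
    ((isIntervalRefinement_intervalStage_self s N).erase_union hp (Finset.singleton_nonempty q)
      (by simpa using hq) (by simp) (by simpa using hqp))
  have hqt : q ∈ intervalStage t n := by simp [htn]
  refine ⟨i, q.1, q.2, by exact_mod_cast hq, hqsub.trans fun z hz ↦
    ⟨(le_max_right _ _).trans_lt hz.1, hz.2.trans_le (min_le_right _ _)⟩,
    ratIcc_subset_of_mem_intervalStage hqt, fun l hl hlq hldisj E ↦ ?_⟩
  have hshrink : ∀ I : ℝ × ℝ, ∃ o : ℚ × ℚ, I.1 < I.2 → o.1 < o.2 ∧ ratIcc o ⊆ Ioo I.1 I.2 := by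
    intro I
    by_cases hI : I.1 < I.2
    · obtain ⟨o, ho⟩ := exists_rat_Icc_subset_Ioo hI
      exact ⟨o, fun _ ↦ ho⟩
    · exact ⟨0, fun h ↦ absurd h hI⟩
  choose c hc using hshrink
  have hcl : ∀ I ∈ l, ratIcc (c I) ⊆ Ioo I.1 I.2 := fun I hI ↦ (hc I (hlq I hI).2.1).2
  obtain ⟨t', m, hnm, htt', htm⟩ := exists_intervalStage_eq t n
    ((isIntervalRefinement_intervalStage_self t n).erase_union hqt (hl.image c)
      (by
        simp only [Finset.forall_mem_image]
        exact fun I hI ↦ (hc I (hlq I hI).2.1).1)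
      (by
        simp only [Finset.forall_mem_image]
        intro I hI J hJ hIJ
        exact (hldisj I hI J hJ fun h ↦ hIJ (congrArg c h)).mono (hcl I hI) (hcl J hJ))
      (by
        simp only [Finset.forall_mem_image]
        exact fun I hI ↦ (hcl I hI).trans fun z hz ↦
          ⟨((hlq I hI).1.trans hz.1).le, (hz.2.trans (hlq I hI).2.2).le⟩))
  obtain ⟨d', hd'E, hd'i, hd'⟩ := hpick t'
    (fun k hk ↦ (htt' k (hk.trans_le hNn)).trans (hts k hk)) m E
  rw [← intervalStage_congr hd'] at htm
  refine ⟨d', hd'E, hd'i, fun z hz ↦ ?_, fun I hI ↦ ?_⟩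
  · obtain ⟨o, ho, hzo⟩ := exists_ratIcc_of_mem_intervalLimit hz.1 m
    rw [htm] at ho
    rcases Finset.mem_union.1 ho with ho | ho
    · exact absurd hz.2 (((isIntervalRefinement_intervalStage_self t n).disjoint o
        (Finset.mem_of_mem_erase ho) q hqt (Finset.ne_of_mem_erase ho)).notMem_of_mem_left hzo)
    · obtain ⟨I, hI, rfl⟩ := Finset.mem_image.1 ho
      exact mem_biUnion hI (hcl I hI hzo)
  · have hmem : c I ∈ intervalStage (binaryDigit (r d')) m := by
      rw [htm]
      exact Finset.mem_union_right _ (Finset.mem_image_of_mem c hI)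
    exact (intervalLimit_inter_nonempty hmem).mono (inter_subset_inter_right _ (hcl I hI))

lemma exists_not_isMeagre_mk_eq_nonMeagerCard :
    ∃ A : Set ℝ, ¬ IsMeagre A ∧ Cardinal.mk A = nonMeagerCard :=
  csInf_mem (s := {c : Cardinal | ∃ A : Set ℝ, ¬ IsMeagre A ∧ Cardinal.mk A = c})
    ⟨_, univ, not_isMeagre_of_isOpen isOpen_univ univ_nonempty, rfl⟩

lemma OnePoint.isOpen_singleton_coe {D : Type*} [TopologicalSpace D] [DiscreteTopology D] (d : D) :
    IsOpen {(d : OnePoint D)} := by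
  rw [← image_singleton]
  exact OnePoint.isOpenEmbedding_coe.isOpenMap _ (isOpen_discrete _)

lemma not_isHereditarilySupercompact_prod_onePoint {D : Type*} [TopologicalSpace D]
    [DiscreteTopology D] {r : D → ℝ} (hr : ¬ IsMeagre (range r)) :
    ¬ IsHereditarilySupercompact (unitInterval × OnePoint D) := by
  intro h
  set K : D → Set ℝ := fun d ↦ intervalLimit (binaryDigit (r d)) with hK
  set Z : Set (unitInterval × OnePoint D) := {z | ∀ d : D, z.2 = d → (z.1 : ℝ) ∈ K d} with hZ
  have hclopen : ∀ d : D, IsClopen {(d : OnePoint D)} := fun d ↦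
    ⟨isClosed_singleton, OnePoint.isOpen_singleton_coe d⟩
  have hZc : IsClosed Z := by
    have : Z = ⋂ d : D, (Prod.snd ⁻¹' {(d : OnePoint D)})ᶜ ∪
        (fun z : unitInterval × OnePoint D ↦ (z.1 : ℝ)) ⁻¹' K d := by
      ext z
      simp [hZ, imp_iff_not_or]
    rw [this]
    exact isClosed_iInter fun d ↦
      (((hclopen d).isOpen.preimage continuous_snd).isClosed_compl).union
        ((isClosed_intervalLimit _).preimage (by fun_prop))
  have : CompactSpace Z := isCompact_iff_compactSpace.1 hZc.isCompact
  let P : ℝ → Z := fun x ↦ ⟨(projIcc 0 1 zero_le_one x, OnePoint.infty), fun d hd ↦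
    absurd hd.symm (OnePoint.coe_ne_infty d)⟩
  let L : D → Set Z := fun d ↦ {z | z.1.2 = d}
  have himage : ∀ d, (fun z : Z ↦ (z.1.1 : ℝ)) '' L d = K d := by
    intro d
    ext x
    constructor
    · rintro ⟨z, hz, rfl⟩
      exact z.2 d hz
    · intro hx
      refine ⟨⟨(⟨x, intervalLimit_subset _ hx⟩, d), fun d' hd' ↦ ?_⟩, rfl, rfl⟩
      rwa [← OnePoint.coe_injective hd']
  refine not_isSupercompact_of_isGenericFamily (X := Z) (π := fun z ↦ (z.1.1 : ℝ)) (P := P) (L := L)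
    (by fun_prop) ?_ ?_ ?_ ?_ ?_ ?_ ?_ (h Z hZc)
  · exact Continuous.subtype_mk (continuous_projIcc.prodMk continuous_const) _
  · intro x hx
    simp [P, projIcc_of_mem zero_le_one hx]
  · exact fun d ↦ (hclopen d).preimage (continuous_snd.comp continuous_subtype_val)
  · intro d
    have := intervalLimit_nonempty (binaryDigit (r d))
    rwa [← image_nonempty, himage d]
  · rintro d z hz z' hz' hzz'
    exact Subtype.ext (Prod.ext (Subtype.ext hzz') (hz.trans hz'.symm))
  · intro x hx O hO hPO
    obtain ⟨V, hV, rfl⟩ := isOpen_induced_iff.1 hO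
    obtain ⟨U, W, hU, hW, hxU, hxW, hUW⟩ := isOpen_prod_iff.1 hV _ _ hPO
    obtain ⟨ε, hε, hεU⟩ := Metric.isOpen_iff.1 hU _ hxU
    have hfin := ((OnePoint.isOpen_iff_of_mem hxW).1 hW).2.finite_of_discrete
    refine ⟨ε, hε, hfin.toFinset, fun d hd z hz hzx ↦ hUW ⟨hεU ?_, ?_⟩⟩
    · rw [projIcc_of_mem zero_le_one hx]
      simpa [Subtype.dist_eq, Real.dist_eq] using hzx
    · rw [show z.1.2 = d from hz]
      simpa using hd
  · have := isGenericFamily_intervalLimit hr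
    simpa only [himage] using this

/-- For a discrete space `D` of cardinality `non(M)`, both `[0,1]` and the one-point
compactification `αD` are hereditarily supercompact but their product `[0,1] × αD` is not:
hereditary supercompactness is not preserved by finite products. -/
theorem hereditary_supercompactness_not_productive
    (D : Type u) [TopologicalSpace D] [DiscreteTopology D]
    (hD : Cardinal.mk D = Cardinal.lift.{u} nonMeagerCard) :
    IsHereditarilySupercompact unitInterval ∧
      IsHereditarilySupercompact (OnePoint D) ∧
      ¬ IsHereditarilySupercompact (unitInterval × OnePoint D) := by
  refine ⟨isHereditarilySupercompact_of_linearOrder, isHereditarilySupercompact_onePoint, ?_⟩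
  obtain ⟨A, hA, hcard⟩ := exists_not_isMeagre_mk_eq_nonMeagerCard
  obtain ⟨e⟩ : Nonempty (D ≃ A) := Cardinal.lift_mk_eq'.1 (by simp [hD, hcard])
  refine not_isHereditarilySupercompact_prod_onePoint (r := fun d ↦ (e d : ℝ)) ?_
  rwa [show range (fun d ↦ (e d : ℝ)) = A by
    rw [← Function.comp_def Subtype.val, e.surjective.range_comp, Subtype.range_coe]]
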